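/- Let p = 3k + 2 be an odd prime and let r be any integer. Then X_p(r) ≡ 1 (mod p), Y_p(r) ≡ 0 (mod p), and Z_p(r) ≡ r^k (mod p). -/

import Mathlib

/-- The Pell-X sequence of parameter `r`. -/
def pellX (r : ℤ) : ℕ → ℤ
  | 0 => 1
  | 1 => 1
  | 2 => 1
  | n + 3 => 3 * pellX r (n + 2) - 3 * pellX r (n + 1) + (r + 1) * pellX r n

/-- The Pell-Y sequence of parameter `r`. -/
def pellY (r : ℤ) : ℕ → ℤ
  | 0 => 0
  | 1 => 1
  | 2 => 2
  | n + 3 => 3 * pellY r (n + 2) - 3 * pellY r (n + 1) + (r + 1) * pellY r n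

/-- The Pell-Z sequence of parameter `r`. -/
def pellZ (r : ℤ) : ℕ → ℤ
  | 0 => 0
  | 1 => 0
  | 2 => 1
  | n + 3 => 3 * pellZ r (n + 2) - 3 * pellZ r (n + 1) + (r + 1) * pellZ r n

theorem pell_succ (r : ℤ) : ∀ n : ℕ,
    pellX r (n + 1) = pellX r n + r * pellZ r n ∧
    pellY r (n + 1) = pellX r n + pellY r n ∧
    pellZ r (n + 1) = pellY r n + pellZ r n
  | 0 => by simp [pellX, pellY, pellZ]
  | 1 => by simp [pellX, pellY, pellZ]
  | 2 => by
    refine ⟨?_, ?_, ?_⟩ <;> simp only [pellX, pellY, pellZ] <;> ring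
  | n + 3 => by
    obtain ⟨hx, hy, hz⟩ := pell_succ r n
    obtain ⟨hx₁, hy₁, hz₁⟩ := pell_succ r (n + 1)
    obtain ⟨hx₂, hy₂, hz₂⟩ := pell_succ r (n + 2)
    refine ⟨?_, ?_, ?_⟩
    · linear_combination 3 * hx₂ - 3 * hx₁ + (r + 1) * hx +
        pellX.eq_4 r (n + 1) - pellX.eq_4 r n - r * pellZ.eq_4 r n
    · linear_combination 3 * hy₂ - 3 * hy₁ + (r + 1) * hy +
        pellY.eq_4 r (n + 1) - pellX.eq_4 r n - pellY.eq_4 r n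
    · linear_combination 3 * hz₂ - 3 * hz₁ + (r + 1) * hz +
        pellZ.eq_4 r (n + 1) - pellY.eq_4 r n - pellZ.eq_4 r n

/-- If `t ^ 3 = r`, the Pell sequences are the coordinates of `(1 + t) ^ n` on `1, t, t ^ 2`. -/
theorem one_add_pow_eq_pell {R : Type*} [Ring R] (r : ℤ) (t : R) (ht : t ^ 3 = r) (n : ℕ) :
    (1 + t) ^ n = pellX r n • (1 : R) + pellY r n • t + pellZ r n • t ^ 2 := by
  induction n with
  | zero => simp [pellX, pellY, pellZ]
  | succ n ih =>
    obtain ⟨hx, hy, hz⟩ := pell_succ r n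
    have ht' : t ^ 2 * t = r • (1 : R) := by rw [← pow_succ, ht, zsmul_one]
    rw [pow_succ, ih, hx, hy, hz]
    simp only [mul_add, add_mul, mul_one, smul_mul_assoc, one_mul, ht', ← pow_two, smul_smul]
    module

/-- The companion matrix of the polynomial `X ^ 3 - r`. -/
def cubeRootMatrix {R : Type*} [CommRing R] (r : R) : Matrix (Fin 3) (Fin 3) R :=
  !![0, 0, r; 1, 0, 0; 0, 1, 0]

theorem cubeRootMatrix_sq {R : Type*} [CommRing R] (r : R) :
    cubeRootMatrix r ^ 2 = !![0, r, 0; 0, 0, r; 1, 0, 0] := by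
  rw [pow_two, cubeRootMatrix]
  ext i j
  fin_cases i <;> fin_cases j <;> simp [Matrix.mul_apply, Fin.sum_univ_three]

theorem cubeRootMatrix_cube {R : Type*} [CommRing R] (r : R) :
    cubeRootMatrix r ^ 3 = r • 1 := by
  rw [pow_succ, cubeRootMatrix_sq, cubeRootMatrix]
  ext i j
  fin_cases i <;> fin_cases j <;> simp [Matrix.mul_apply, Fin.sum_univ_three]

theorem stmt_11 (p k : ℕ) (hp : p.Prime) (hodd : Odd p) (hpk : p = 3 * k + 2) (r : ℤ) :
    pellX r p ≡ 1 [ZMOD (p : ℤ)] ∧ pellY r p ≡ 0 [ZMOD (p : ℤ)] ∧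
      pellZ r p ≡ r ^ k [ZMOD (p : ℤ)] := by
  have : Fact p.Prime := ⟨hp⟩
  set t : Matrix (Fin 3) (Fin 3) (ZMod p) := cubeRootMatrix (r : ZMod p) with ht
  have hcube : t ^ 3 = (r : ZMod p) • 1 := cubeRootMatrix_cube _
  have hpell := one_add_pow_eq_pell r t (by rw [hcube, Int.cast_smul_eq_zsmul, zsmul_one]) p
  have htp : t ^ p = (r : ZMod p) ^ k • t ^ 2 := by
    calc t ^ p = t ^ (3 * k + 2) := congrArg (t ^ ·) hpk
      _ = (r : ZMod p) ^ k • t ^ 2 := by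
        rw [pow_add, pow_mul, hcube, smul_pow, one_pow, smul_mul_assoc, one_mul]
  rw [add_pow_char_of_commute (p := p) (Commute.one_left t), one_pow, htp, ht,
    cubeRootMatrix_sq, cubeRootMatrix] at hpell
  have entry (i : Fin 3) := congrFun (congrFun hpell i) 0
  simp only [Matrix.add_apply, Matrix.smul_apply, Matrix.one_apply] at entry
  have h₀ := entry 0
  have h₁ := entry 1
  have h₂ := entry 2
  simp at h₀ h₁ h₂
  simp only [← ZMod.intCast_eq_intCast_iff]
  push_cast
  exact ⟨h₀.symm, h₁.symm, h₂.symm⟩
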